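/- Let L = {1, …, K} index power levels with values 0 < P_1 < P_2 < ⋯ < P_K, let a_β ≥ 0 and a_b ≥ 0 be attenuation coefficients, and let δ > 0 and N > 0 be reals. Let x ∈ {0,1}, v : L → {0,1}, z : L → {0,1} satisfy the generalized upper bound constraints ∑_{l=1}^{K} v_l ≤ 1 and ∑_{l=1}^{K} z_l ≤ 1, together with the relaxed (single-server, single-interferer) SIR constraint: x = 1 implies a_β · ∑_{l=1}^{K} P_l · v_l − δ · a_b · ∑_{l=1}^{K} P_l · z_l ≥ δ · N. Suppose λ, q ∈ {1, …, K} are levels such that a_β · P_λ < δ · (N + a_b · P_q). Then the GUB cover inequality x + ∑_{l=1}^{λ} v_l + ∑_{l=q}^{K} z_l ≤ 2 holds. -/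

import Mathlib

theorem gub_aux (S T : Finset ℕ) (hST : S ⊆ T) (w f : ℕ → ℝ)
    (hw : ∀ l ∈ T, w l = 0 ∨ w l = 1) (hs : ∑ l ∈ T, w l ≤ 1) :
    ∑ l ∈ S, w l ≤ 1 ∧ (∑ l ∈ S, w l = 0 ∨ ∃ j ∈ S, ∑ l ∈ T, f l * w l = f j) := by
  have hnn : ∀ l ∈ T, 0 ≤ w l := fun l hl => by
    rcases hw l hl with h | h <;> rw [h] <;> norm_num
  refine ⟨(Finset.sum_le_sum_of_subset_of_nonneg hST (fun l hl _ => hnn l hl)).trans hs, ?_⟩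
  by_cases hex : ∃ j ∈ S, w j = 1
  · right
    obtain ⟨j, hj, hj1⟩ := hex
    refine ⟨j, hj, ?_⟩
    have hz : ∀ l ∈ T, l ≠ j → w l = 0 := by
      intro l hl hne
      have h1 := Finset.add_sum_erase T w (hST hj)
      have h2 := Finset.single_le_sum (f := w) (s := T.erase j)
        (fun i hi => hnn i (Finset.mem_of_mem_erase hi)) (Finset.mem_erase.2 ⟨hne, hl⟩)
      have h3 := hnn l hl
      linarith
    rw [Finset.sum_eq_single_of_mem j (hST hj) (fun l hl hne => by rw [hz l hl hne, mul_zero]),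
      hj1, mul_one]
  · left
    refine Finset.sum_eq_zero fun l hl => ?_
    rcases hw l (hST hl) with h | h
    · exact h
    · exact absurd ⟨l, hl, h⟩ hex

/-- Validity of the GUB cover inequality for the relaxed
(single-server `β`, single-interferer `b`) Power-Indexed SIR constraint.
Power levels are `1, …, K` with strictly increasing positive values `P l`;
`v l` indicates service by `β` at level `l`, `z l` emission of `b` at level `l`,
`x` indicates that the terminal is served. If the pair of levels `(lam, q)` is
service-destroying, i.e. `aβ * P lam < δ * (N + ab * P q)`, then
`x + ∑_{l=1}^{lam} v l + ∑_{l=q}^{K} z l ≤ 2`. -/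
theorem gub_cover_inequality_valid (K : ℕ) (hK : 1 ≤ K) (P : ℕ → ℝ)
    (hP1 : 0 < P 1)
    (hPmono : ∀ l ∈ Finset.Icc 1 K, ∀ l' ∈ Finset.Icc 1 K, l < l' → P l < P l')
    (aβ ab : ℝ) (haβ : 0 ≤ aβ) (hab : 0 ≤ ab)
    (δ N : ℝ) (hδ : 0 < δ) (hN : 0 < N)
    (x : ℝ) (hx : x = 0 ∨ x = 1)
    (v z : ℕ → ℝ)
    (hv : ∀ l ∈ Finset.Icc 1 K, v l = 0 ∨ v l = 1)
    (hz : ∀ l ∈ Finset.Icc 1 K, z l = 0 ∨ z l = 1)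
    (hgubv : ∑ l ∈ Finset.Icc 1 K, v l ≤ 1)
    (hgubz : ∑ l ∈ Finset.Icc 1 K, z l ≤ 1)
    (hsir : x = 1 →
      aβ * (∑ l ∈ Finset.Icc 1 K, P l * v l)
        - δ * (ab * (∑ l ∈ Finset.Icc 1 K, P l * z l)) ≥ δ * N)
    (lam q : ℕ) (hlam : lam ∈ Finset.Icc 1 K) (hq : q ∈ Finset.Icc 1 K)
    (hdestroy : aβ * P lam < δ * (N + ab * P q)) :
    x + (∑ l ∈ Finset.Icc 1 lam, v l) + (∑ l ∈ Finset.Icc q K, z l) ≤ 2 := by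
  have hl := Finset.mem_Icc.1 hlam
  have hq' := Finset.mem_Icc.1 hq
  obtain ⟨hV, hV'⟩ := gub_aux (Finset.Icc 1 lam) (Finset.Icc 1 K)
    (Finset.Icc_subset_Icc le_rfl hl.2) v P hv hgubv
  obtain ⟨hZ, hZ'⟩ := gub_aux (Finset.Icc q K) (Finset.Icc 1 K)
    (Finset.Icc_subset_Icc hq'.1 le_rfl) z P hz hgubz
  have hmono : ∀ i j, 1 ≤ i → i ≤ j → j ≤ K → P i ≤ P j := by
    intro i j hi hij hj
    rcases hij.eq_or_lt with h | h
    · rw [h]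
    · exact (hPmono i (Finset.mem_Icc.2 ⟨hi, hij.trans hj⟩) j
        (Finset.mem_Icc.2 ⟨hi.trans hij, hj⟩) h).le
  rcases hx with hx | hx
  · linarith
  rcases hV' with h | ⟨j, hj, hjv⟩
  · linarith
  rcases hZ' with h | ⟨k, hk, hkz⟩
  · linarith
  exfalso
  have hs := hsir hx
  rw [hjv, hkz] at hs
  rw [Finset.mem_Icc] at hj hk
  have h1 := mul_le_mul_of_nonneg_left (hmono j lam hj.1 hj.2 hl.2) haβ
  have h2 := mul_le_mul_of_nonneg_left
    (mul_le_mul_of_nonneg_left (hmono q k hq'.1 hk.1 hk.2) hab) hδ.le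
  linarith
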